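/- Let (G,H) be a finite Gelfand pair. A nonzero bi-H-invariant function ω: G → C is a zonal spherical function if and only if for all g, k ∈ G: (1/|H|) Σ_{h∈H} ω(g h k) = ω(g)·ω(k). -/

import Mathlib

open scoped ComplexInnerProductSpace Classical

/-- Convolution of complex-valued functions on a finite group:
`(f₁ * f₂)(x) = Σ_t f₁(t) f₂(t⁻¹ x)`. -/
noncomputable def conv {G : Type*} [Group G] [Fintype G] (f₁ f₂ : G → ℂ) (x : G) : ℂ :=
  ∑ t, f₁ t * f₂ (t⁻¹ * x)

/-- A function on `G` is bi-`H`-invariant if `f(h₁ g h₂) = f(g)` for all `h₁, h₂ ∈ H`. -/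
def BiInvariant {G : Type*} [Group G] (H : Subgroup G) (f : G → ℂ) : Prop :=
  ∀ h₁ ∈ H, ∀ (g : G), ∀ h₂ ∈ H, f (h₁ * g * h₂) = f g

section SphericalFunctions

variable {G : Type*} [Group G]

section Hecke

variable {V : Type*} [AddCommGroup V] [Module ℂ V]

/-- The subspace of vectors fixed by a subgroup. -/
def fixedSubmodule (H : Subgroup G) (ρ : Representation ℂ G V) : Submodule ℂ V where
  carrier := {x | ∀ h ∈ H, ρ h x = x}
  add_mem' hx hy h hh := by rw [map_add, hx h hh, hy h hh]
  zero_mem' h _ := map_zero _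
  smul_mem' c x hx h hh := by rw [map_smul, hx h hh]

variable [Fintype G] (H : Subgroup G)

/-- The action of a function on the group by the integrated representation. -/
noncomputable def integratedRep (ρ : Representation ℂ G V) (f : G → ℂ) : Module.End ℂ V :=
  ∑ x, f x • ρ x

lemma integratedRep_conv (ρ : Representation ℂ G V) (f₁ f₂ : G → ℂ) :
    integratedRep ρ (conv f₁ f₂) = integratedRep ρ f₁ * integratedRep ρ f₂ := by
  simp only [integratedRep, conv, Finset.sum_smul, Finset.sum_mul_sum]
  rw [Finset.sum_comm]
  refine Finset.sum_congr rfl fun t _ => ?_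
  refine Fintype.sum_equiv (Equiv.mulLeft t⁻¹) _ _ fun x => ?_
  rw [smul_mul_smul_comm, ← map_mul]
  simp

/-- The function counting the representations `x = h₁ g h₂` with `h₁, h₂ ∈ H`. -/
noncomputable def doubleCosetCount (g x : G) : ℂ :=
  ∑ h₁ : H, ∑ h₂ : H, if (h₁ : G) * g * h₂ = x then 1 else 0

lemma biInvariant_doubleCosetCount (g : G) : BiInvariant H (doubleCosetCount H g) := by
  intro a ha x b hb
  unfold doubleCosetCount
  refine Fintype.sum_equiv (Equiv.mulLeft (⟨a, ha⟩⁻¹ : H)) _ _ fun h₁ => ?_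
  refine Fintype.sum_equiv (Equiv.mulRight (⟨b, hb⟩⁻¹ : H)) _ _ fun h₂ => ?_
  congr 1
  simp only [Equiv.coe_mulLeft, Equiv.coe_mulRight, Subgroup.coe_mul, Subgroup.coe_inv]
  refine propext ⟨fun h => ?_, fun h => ?_⟩
  · have : (a⁻¹ * (h₁ * g * h₂) * b⁻¹ : G) = x := by rw [h]; group
    rw [← this]; group
  · rw [← h]; group

/-- The double coset operator `∑ ρ(h₁ g h₂)` over `h₁, h₂ ∈ H`. -/
noncomputable def doubleCosetOperator (ρ : Representation ℂ G V) (g : G) : Module.End ℂ V :=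
  ∑ h₁ : H, ∑ h₂ : H, ρ (h₁ * g * h₂)

lemma integratedRep_doubleCosetCount (ρ : Representation ℂ G V) (g : G) :
    integratedRep ρ (doubleCosetCount H g) = doubleCosetOperator H ρ g := by
  simp only [integratedRep, doubleCosetCount, doubleCosetOperator, Finset.sum_smul]
  rw [Finset.sum_comm]
  refine Finset.sum_congr rfl fun h₁ _ => ?_
  rw [Finset.sum_comm]
  refine Finset.sum_congr rfl fun h₂ _ => ?_
  simp

lemma doubleCosetOperator_commute
    (hGelfand : ∀ f₁ f₂ : G → ℂ, BiInvariant H f₁ → BiInvariant H f₂ →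
      conv f₁ f₂ = conv f₂ f₁) (ρ : Representation ℂ G V) (g k : G) :
    doubleCosetOperator H ρ g * doubleCosetOperator H ρ k =
      doubleCosetOperator H ρ k * doubleCosetOperator H ρ g := by
  simp only [← integratedRep_doubleCosetCount, ← integratedRep_conv]
  rw [hGelfand _ _ (biInvariant_doubleCosetCount H g) (biInvariant_doubleCosetCount H k)]

variable {H} in
lemma sum_apply_mem_fixedSubmodule (ρ : Representation ℂ G V) (x : V) :
    ∑ h : H, ρ h x ∈ fixedSubmodule H ρ := by
  intro a ha
  rw [map_sum]
  refine Fintype.sum_equiv (Equiv.mulLeft (⟨a, ha⟩ : H)) _ _ fun h => ?_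
  simp

lemma doubleCosetOperator_apply_of_mem (ρ : Representation ℂ G V) (g : G) {x : V}
    (hx : x ∈ fixedSubmodule H ρ) :
    doubleCosetOperator H ρ g x = (Nat.card H : ℂ) • ∑ h : H, ρ h (ρ g x) := by
  simp only [doubleCosetOperator, LinearMap.sum_apply, map_mul, Module.End.mul_apply]
  rw [Finset.smul_sum]
  refine Finset.sum_congr rfl fun h₁ _ => ?_
  rw [Finset.sum_congr rfl fun (h₂ : H) _ => by rw [hx h₂ h₂.2], Finset.sum_const,
    Finset.card_univ, Nat.card_eq_fintype_card, Nat.cast_smul_eq_nsmul]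

/-- For a Gelfand pair, each double coset operator is scalar on the fixed vectors of an
irreducible representation. -/
lemma exists_doubleCosetOperator_eq_smul [FiniteDimensional ℂ V]
    (hGelfand : ∀ f₁ f₂ : G → ℂ, BiInvariant H f₁ → BiInvariant H f₂ →
      conv f₁ f₂ = conv f₂ f₁) (ρ : Representation ℂ G V)
    (hirr : ∀ U : Submodule ℂ V, (∀ (g : G), ∀ x ∈ U, ρ g x ∈ U) → U = ⊥ ∨ U = ⊤)
    (g : G) {v : V} (hv : v ∈ fixedSubmodule H ρ) :
    ∃ μ : ℂ, doubleCosetOperator H ρ g v = μ • v := by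
  rcases eq_or_ne v 0 with rfl | hv0
  · exact ⟨0, by simp⟩
  have hc : (Nat.card H : ℂ) ≠ 0 := Nat.cast_ne_zero.mpr Nat.card_pos.ne'
  have hmaps : ∀ x ∈ fixedSubmodule H ρ, doubleCosetOperator H ρ g x ∈ fixedSubmodule H ρ := by
    intro x hx
    rw [doubleCosetOperator_apply_of_mem H ρ g hx]
    exact Submodule.smul_mem _ _ (sum_apply_mem_fixedSubmodule ρ _)
  have : Nontrivial (fixedSubmodule H ρ) :=
    ⟨⟨⟨v, hv⟩, 0, fun h => hv0 (congrArg Subtype.val h)⟩⟩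
  obtain ⟨μ, hμ⟩ := Module.End.exists_eigenvalue ((doubleCosetOperator H ρ g).restrict hmaps)
  obtain ⟨⟨u, hu⟩, hμu⟩ := hμ.exists_hasEigenvector
  have hgu : doubleCosetOperator H ρ g u = μ • u := congrArg Subtype.val hμu.apply_eq_smul
  have hu0 : u ≠ 0 := fun h => hμu.2 (Subtype.ext h)
  have htop : Submodule.span ℂ (Set.range fun k => ρ k u) = ⊤ := by
    refine (hirr _ fun k x hx => ?_).resolve_left fun hbot => hu0 ?_
    · induction hx using Submodule.span_induction with
      | mem x hx =>
        obtain ⟨l, rfl⟩ := hx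
        exact Submodule.subset_span ⟨k * l, by simp⟩
      | zero => simp
      | add x y _ _ hx hy => rw [map_add]; exact add_mem hx hy
      | smul c x _ hx => rw [map_smul]; exact Submodule.smul_mem _ _ hx
    · have : u ∈ Submodule.span ℂ (Set.range fun k => ρ k u) :=
        Submodule.subset_span ⟨1, by simp⟩
      rwa [hbot, Submodule.mem_bot] at this
  have key : ∀ x : V, doubleCosetOperator H ρ g (∑ h : H, ρ h x) = μ • ∑ h : H, ρ h x := by
    intro x
    have hx : x ∈ Submodule.span ℂ (Set.range fun k => ρ k u) := htop ▸ Submodule.mem_top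
    induction hx using Submodule.span_induction with
    | mem x hx =>
      obtain ⟨k, rfl⟩ := hx
      have h := LinearMap.congr_fun (doubleCosetOperator_commute H hGelfand ρ g k) u
      rw [Module.End.mul_apply, Module.End.mul_apply, hgu, map_smul,
        doubleCosetOperator_apply_of_mem H ρ k hu, map_smul, smul_comm μ] at h
      exact smul_right_injective V hc h
    | zero => simp
    | add x y _ _ hx hy => simp only [map_add, Finset.sum_add_distrib, hx, hy, smul_add]
    | smul c x _ hx => simp only [map_smul, ← Finset.smul_sum, hx, smul_comm c]
  have hsum : ∑ h : H, ρ h v = (Nat.card H : ℂ) • v := by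
    rw [Finset.sum_congr rfl fun (h : H) _ => hv h h.2, Finset.sum_const, Finset.card_univ,
      Nat.card_eq_fintype_card, Nat.cast_smul_eq_nsmul]
  refine ⟨μ, smul_right_injective V hc ?_⟩
  have h := key v
  rw [hsum, map_smul, smul_comm μ] at h
  exact h

end Hecke

lemma sum_matrixCoeff_eq_mul [Fintype G] (H : Subgroup G)
    (hGelfand : ∀ f₁ f₂ : G → ℂ, BiInvariant H f₁ → BiInvariant H f₂ →
      conv f₁ f₂ = conv f₂ f₁)
    {V : Type*} [NormedAddCommGroup V] [InnerProductSpace ℂ V] [FiniteDimensional ℂ V]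
    (ρ : Representation ℂ G V) (hρ : ∀ (g : G) (x y : V), ⟪ρ g x, ρ g y⟫ = ⟪x, y⟫)
    (hirr : ∀ U : Submodule ℂ V, (∀ (g : G), ∀ x ∈ U, ρ g x ∈ U) → U = ⊥ ∨ U = ⊤)
    {v : V} (hv1 : ‖v‖ = 1) (hv : ∀ h ∈ H, ρ h v = v) (g k : G) :
    ∑ h : H, ⟪v, ρ (g * h * k) v⟫ = Nat.card H * (⟪v, ρ g v⟫ * ⟪v, ρ k v⟫) := by
  have hc : (Nat.card H : ℂ) ≠ 0 := Nat.cast_ne_zero.mpr Nat.card_pos.ne'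
  have hvv : ⟪v, v⟫ = (1 : ℂ) := by rw [inner_self_eq_norm_sq_to_K, hv1]; simp
  obtain ⟨μ, hμ⟩ := exists_doubleCosetOperator_eq_smul H hGelfand ρ hirr k (v := v) hv
  rw [doubleCosetOperator_apply_of_mem H ρ k hv] at hμ
  have hinv : ∀ h : H, ⟪v, ρ h (ρ k v)⟫ = ⟪v, ρ k v⟫ := fun h => by
    rw [← hρ h v (ρ k v), hv h h.2]
  have hμ' : Nat.card H * (Nat.card H * ⟪v, ρ k v⟫) = μ := by
    have h := congrArg (fun x => ⟪v, x⟫) hμ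
    simpa only [inner_smul_right, inner_sum, hinv, hvv, mul_one, Finset.sum_const,
      Finset.card_univ, ← Nat.card_eq_fintype_card, nsmul_eq_mul] using h
  have hsum : ∑ h : H, ρ h (ρ k v) = (Nat.card H * ⟪v, ρ k v⟫ : ℂ) • v := by
    refine smul_right_injective V hc ?_
    simp only [hμ, smul_smul, hμ']
  calc ∑ h : H, ⟪v, ρ (g * h * k) v⟫ = ⟪v, ρ g (∑ h : H, ρ h (ρ k v))⟫ := by
        simp only [map_sum, inner_sum, map_mul, Module.End.mul_apply]
    _ = _ := by rw [hsum, map_smul, inner_smul_right]; ring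

/-- Right translation of functions on `G`, where `G` is identified with an index type by `e`. -/
noncomputable def rightTranslation {ι : Type*} (e : G ≃ ι) :
    Representation ℂ G (EuclideanSpace ℂ ι) where
  toFun g :=
    { toFun := fun f => WithLp.toLp 2 fun i => f (e (e.symm i * g))
      map_add' := fun _ _ => rfl
      map_smul' := fun _ _ => rfl }
  map_one' := by ext f i; simp
  map_mul' g k := by
    ext f i
    change f (e (e.symm i * (g * k))) = f (e (e.symm (e (e.symm i * g)) * k))
    rw [Equiv.symm_apply_apply, mul_assoc]

lemma rightTranslation_apply {ι : Type*} (e : G ≃ ι) (g : G) (f : EuclideanSpace ℂ ι) (i : ι) :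
    rightTranslation e g f i = f (e (e.symm i * g)) := rfl

lemma inner_rightTranslation {ι : Type*} [Fintype ι] (e : G ≃ ι) (g : G)
    (x y : EuclideanSpace ℂ ι) :
    ⟪rightTranslation e g x, rightTranslation e g y⟫ = ⟪x, y⟫ := by
  simp only [PiLp.inner_apply, rightTranslation_apply]
  exact Fintype.sum_equiv (e.symm.trans ((Equiv.mulRight g).trans e)) _ _ fun i => rfl

lemma exists_irreducible_of_functional_equation [Fintype G] (H : Subgroup G)
    (ω : G → ℂ) (hω0 : ω ≠ 0) (hωinv : BiInvariant H ω)
    (hω : ∀ g k : G, ∑ h : H, ω (g * h * k) = Nat.card H * (ω g * ω k)) :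
    ∃ (V : Type) (_ : NormedAddCommGroup V) (_ : InnerProductSpace ℂ V)
        (_ : FiniteDimensional ℂ V) (ρ : Representation ℂ G V) (v : V),
        (∀ (g : G) (x y : V), ⟪ρ g x, ρ g y⟫ = ⟪x, y⟫) ∧
        (∀ U : Submodule ℂ V, (∀ (g : G), ∀ x ∈ U, ρ g x ∈ U) → U = ⊥ ∨ U = ⊤) ∧
        ‖v‖ = 1 ∧ (∀ h ∈ H, ρ h v = v) ∧ ω = fun g => ⟪v, ρ g v⟫ := by
  have hc : (Nat.card H : ℂ) ≠ 0 := Nat.cast_ne_zero.mpr Nat.card_pos.ne'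
  let e := Fintype.equivFin G
  let R := rightTranslation e
  let w : EuclideanSpace ℂ (Fin (Fintype.card G)) := WithLp.toLp 2 fun i => ω (e.symm i)
  have hw : ∀ x, w (e x) = ω x := fun x => congrArg ω (e.symm_apply_apply x)
  have hw0 : w ≠ 0 := fun h => hω0 <| funext fun x => by rw [← hw, h]; rfl
  let W := Submodule.span ℂ (Set.range fun k => R k w)
  have hwW : w ∈ W := Submodule.subset_span ⟨1, by simp⟩
  have hRW : ∀ g, ∀ x ∈ W, R g x ∈ W := fun g x hx => by
    induction hx using Submodule.span_induction with
    | mem x hx =>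
      obtain ⟨l, rfl⟩ := hx
      exact Submodule.subset_span ⟨g * l, by simp⟩
    | zero => simp
    | add x y _ _ hx hy => rw [map_add]; exact add_mem hx hy
    | smul c x _ hx => rw [map_smul]; exact Submodule.smul_mem _ _ hx
  have havg : ∀ y, ∀ f ∈ W, ∑ h : H, R (h * y) f = (Nat.card H * f (e y) : ℂ) • w := by
    intro y f hf
    induction hf using Submodule.span_induction with
    | mem x hx =>
      obtain ⟨k, rfl⟩ := hx
      ext i
      have h := hω (e.symm i) (y * k)
      simp only [← hw] at h
      simp only [WithLp.ofLp_sum, Finset.sum_apply, R, rightTranslation_apply, PiLp.smul_apply,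
        smul_eq_mul, Equiv.symm_apply_apply]
      simp only [mul_assoc, Equiv.apply_symm_apply] at h ⊢
      rw [h]; ring
    | zero => simp
    | add x z _ _ hx hz =>
      simp only [map_add, Finset.sum_add_distrib, hx, hz, PiLp.add_apply, mul_add, add_smul]
    | smul c x _ hx =>
      simp only [map_smul, ← Finset.smul_sum, hx, PiLp.smul_apply, smul_smul, smul_eq_mul]
      congr 1; ring
  have hfix : ∀ h ∈ H, R h w = w := fun h hh => by
    ext i
    simp only [R, rightTranslation_apply, hw]
    simpa using hωinv 1 H.one_mem (e.symm i) h hh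
  have hcoeff : ∀ g, ⟪w, R g w⟫ = ω g * ⟪w, w⟫ := fun g => by
    have hinv : ∀ h : H, ⟪w, R (h * g) w⟫ = ⟪w, R g w⟫ := fun h => by
      rw [← inner_rightTranslation e h w (R g w), map_mul, Module.End.mul_apply]
      change _ = ⟪R h w, _⟫
      rw [hfix h h.2]
    have h := congrArg (fun x => ⟪w, x⟫) (havg g w hwW)
    simp only [inner_sum, hinv, inner_smul_right, hw, Finset.sum_const, Finset.card_univ,
      ← Nat.card_eq_fintype_card, nsmul_eq_mul, mul_assoc] at h
    exact mul_left_cancel₀ hc h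
  let ρ : Representation ℂ G W :=
    { toFun := fun g => (R g).restrict (hRW g)
      map_one' := by ext x : 2; simp
      map_mul' := fun g k => by ext x : 2; simp }
  have hρ : ∀ g (x : W), (ρ g x : EuclideanSpace ℂ _) = R g x := fun _ _ => rfl
  refine ⟨W, inferInstance, inferInstance, inferInstance, ρ, (‖w‖⁻¹ : ℂ) • ⟨w, hwW⟩,
    fun g x y => inner_rightTranslation e g _ _, fun U hU => ?_, ?_, fun h hh => ?_, ?_⟩
  · refine or_iff_not_imp_left.mpr fun hbot => ?_
    obtain ⟨f, hfU, hf0⟩ := Submodule.exists_mem_ne_zero_of_ne_bot hbot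
    obtain ⟨y, hy⟩ : ∃ y, f.1 (e y) ≠ 0 := by
      by_contra! hall
      refine hf0 (Subtype.ext ?_)
      ext i
      simpa using hall (e.symm i)
    have hwU : (⟨w, hwW⟩ : W) ∈ U := by
      have hsum : ∑ h : H, ρ (h * y) f = (Nat.card H * f.1 (e y) : ℂ) • (⟨w, hwW⟩ : W) := by
        refine Subtype.ext ?_
        simpa only [Submodule.coe_sum, hρ, Submodule.coe_smul] using havg y f.1 f.2
      have hmem : ∑ h : H, ρ (h * y) f ∈ U := sum_mem fun h _ => hU _ _ hfU
      rw [hsum] at hmem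
      exact (Submodule.smul_mem_iff _ (mul_ne_zero hc hy)).mp hmem
    have hle : W ≤ U.map W.subtype := Submodule.span_le.mpr <| by
      rintro _ ⟨k, rfl⟩
      exact ⟨_, hU k _ hwU, rfl⟩
    refine eq_top_iff.mpr fun x _ => ?_
    obtain ⟨z, hz, hzx⟩ := hle x.2
    rwa [← Subtype.ext hzx]
  · rw [norm_smul, Submodule.coe_norm, norm_inv, Complex.norm_real, norm_norm]
    exact inv_mul_cancel₀ (norm_ne_zero_iff.mpr hw0)
  · rw [map_smul]
    congr 1
    exact Subtype.ext (hfix h hh)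
  · funext g
    have hn : (‖w‖ : ℂ) ≠ 0 := Complex.ofReal_ne_zero.mpr (norm_ne_zero_iff.mpr hw0)
    change ω g = ⟪(‖w‖⁻¹ : ℂ) • w, R g ((‖w‖⁻¹ : ℂ) • w)⟫
    rw [map_smul, inner_smul_left, inner_smul_right, hcoeff, inner_self_eq_norm_sq_to_K,
      map_inv₀, Complex.conj_ofReal]
    change ω g = (‖w‖ : ℂ)⁻¹ * ((‖w‖ : ℂ)⁻¹ * (ω g * (‖w‖ : ℂ) ^ 2))
    field_simp

end SphericalFunctions

/-- Let `(G,H)` be a finite Gelfand pair. A nonzero bi-`H`-invariant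
function `ω : G → ℂ` is a zonal spherical function — i.e. `ω(g) = ⟪v, g·v⟫` for a unit
`H`-fixed vector `v` in an irreducible unitary constituent of `Ind_H^G 1` — if and only if
`(1/|H|) Σ_{h ∈ H} ω(g h k) = ω(g)·ω(k)` for all `g, k ∈ G`. -/
theorem spherical_iff_functional_equation {G : Type*} [Group G] [Fintype G] (H : Subgroup G)
    (hGelfand : ∀ f₁ f₂ : G → ℂ, BiInvariant H f₁ → BiInvariant H f₂ →
      conv f₁ f₂ = conv f₂ f₁)
    (ω : G → ℂ) (hω0 : ω ≠ 0) (hωinv : BiInvariant H ω) :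
    (∃ (V : Type) (_ : NormedAddCommGroup V) (_ : InnerProductSpace ℂ V)
        (_ : FiniteDimensional ℂ V) (ρ : Representation ℂ G V) (v : V),
        (∀ (g : G) (x y : V), ⟪ρ g x, ρ g y⟫ = ⟪x, y⟫) ∧
        (∀ U : Submodule ℂ V, (∀ (g : G), ∀ x ∈ U, ρ g x ∈ U) → U = ⊥ ∨ U = ⊤) ∧
        ‖v‖ = 1 ∧ (∀ h ∈ H, ρ h v = v) ∧ ω = fun g => ⟪v, ρ g v⟫) ↔
      (∀ g k : G, (1 / (Nat.card H : ℂ)) * ∑ h : H, ω (g * (h : G) * k) = ω g * ω k) := by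
  have hc : (Nat.card H : ℂ) ≠ 0 := Nat.cast_ne_zero.mpr Nat.card_pos.ne'
  constructor
  · rintro ⟨V, _, _, _, ρ, v, hρ, hirr, hv1, hv, rfl⟩ g k
    rw [sum_matrixCoeff_eq_mul H hGelfand ρ hρ hirr hv1 hv, one_div, inv_mul_cancel_left₀ hc]
  · intro h
    refine exists_irreducible_of_functional_equation H ω hω0 hωinv fun g k => ?_
    rw [← h, one_div, mul_inv_cancel_left₀ hc]
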